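/- For all integers k, k' with 1 ≤ k ≤ k' ≤ n it holds that app(k) ≤ opt(k') + M·(n−k)/(k+1), where M := M_∞·p̄ − m_∞·p. -/

import Mathlib

open scoped BigOperators

/-- Dot product of two vectors in `ℝ^ν`. -/
noncomputable def dot {ν : ℕ} (c x : Fin ν → ℝ) : ℝ := ∑ j, c j * x j

/-- `convComb X k` is the set `X(k)` of all convex combinations of at most `k` points of `X`. -/
def convComb {ν : ℕ} (X : Set (Fin ν → ℝ)) (k : ℕ) : Set (Fin ν → ℝ) :=
  { x | ∃ (xs : Fin k → (Fin ν → ℝ)) (lam : Fin k → ℝ),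
      (∀ i, xs i ∈ X) ∧ (∀ i, 0 ≤ lam i) ∧ (∑ i, lam i) = 1 ∧
      x = ∑ i, lam i • xs i }

/-- The worst-case objective `max_{c ∈ U} cᵀx`. -/
noncomputable def objSup {ν : ℕ} (U : Set (Fin ν → ℝ)) (x : Fin ν → ℝ) : ℝ :=
  sSup ((fun c => dot c x) '' U)

/-- `opt(k) = min_{x ∈ X(k)} max_{c ∈ U} cᵀx`. -/
noncomputable def optVal {ν : ℕ} (X U : Set (Fin ν → ℝ)) (k : ℕ) : ℝ :=
  sInf (objSup U '' convComb X k)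

/-- `‖x‖₀`, the number of nonzero entries of `x`, as a real number. -/
noncomputable def zeroNorm {ν : ℕ} (x : Fin ν → ℝ) : ℝ :=
  ((Finset.univ.filter (fun j => x j ≠ 0)).card : ℝ)

/-- The min-max-min robust value over `k`-tuples of feasible solutions:
`min_{x¹,…,x^k ∈ X} max_{c ∈ U} min_{i} cᵀxⁱ`. -/
noncomputable def minmaxVal {ν : ℕ} (X U : Set (Fin ν → ℝ)) (k : ℕ) : ℝ :=
  sInf { v : ℝ | ∃ xs : Fin k → (Fin ν → ℝ), (∀ i, xs i ∈ X) ∧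
    v = sSup ((fun c => ⨅ i, dot c (xs i)) '' U) }

/-- `app(k)`, the objective value of the `k` solutions `x¹,…,x^k` with largest weights
returned by Algorithm 1: `max_{c ∈ U} min_{i=1,…,k} cᵀxⁱ`. -/
noncomputable def appVal {ν : ℕ} (U : Set (Fin ν → ℝ)) (xs : Fin ν → (Fin ν → ℝ)) (k : ℕ) : ℝ :=
  sSup ((fun c => ⨅ i : {i : Fin ν // (i : ℕ) < k}, dot c (xs i.1)) '' U)

lemma dot_sum_smul {ν : ℕ} {ι : Type*} (s : Finset ι) (c : Fin ν → ℝ) (lam : ι → ℝ)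
    (xs : ι → Fin ν → ℝ) :
    dot c (∑ i ∈ s, lam i • xs i) = ∑ i ∈ s, lam i * dot c (xs i) := by
  simp only [dot, Finset.sum_apply, Pi.smul_apply, smul_eq_mul, Finset.mul_sum]
  rw [Finset.sum_comm]
  exact Finset.sum_congr rfl fun i _ => Finset.sum_congr rfl fun j _ => by ring

lemma dot_eq_sum_support {ν : ℕ} (c x : Fin ν → ℝ) (hx : ∀ j, x j = 0 ∨ x j = 1) :
    dot c x = ∑ j ∈ Finset.univ.filter (fun j => x j ≠ 0), c j := by
  rw [dot, Finset.sum_filter]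
  refine Finset.sum_congr rfl fun j _ => ?_
  rcases hx j with h | h <;> simp [h]

lemma le_dot_of_binary {ν : ℕ} {c x : Fin ν → ℝ} {m p : ℝ} (hx : ∀ j, x j = 0 ∨ x j = 1)
    (hm : 0 ≤ m) (hc : ∀ j, m ≤ c j) (hp : p ≤ zeroNorm x) : m * p ≤ dot c x := by
  rw [dot_eq_sum_support c x hx]
  calc m * p ≤ m * zeroNorm x := mul_le_mul_of_nonneg_left hp hm
    _ = (Finset.univ.filter (fun j => x j ≠ 0)).card • m := by
      rw [nsmul_eq_mul, mul_comm, zeroNorm]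
    _ ≤ _ := Finset.card_nsmul_le_sum _ _ _ fun j _ => hc j

lemma dot_le_of_binary {ν : ℕ} {c x : Fin ν → ℝ} {M p : ℝ} (hx : ∀ j, x j = 0 ∨ x j = 1)
    (hM : 0 ≤ M) (hc : ∀ j, c j ≤ M) (hp : zeroNorm x ≤ p) : dot c x ≤ M * p := by
  rw [dot_eq_sum_support c x hx]
  calc _ ≤ (Finset.univ.filter (fun j => x j ≠ 0)).card • M :=
        Finset.sum_le_card_nsmul _ _ _ fun j _ => hc j
    _ = M * zeroNorm x := by rw [nsmul_eq_mul, mul_comm, zeroNorm]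
    _ ≤ M * p := mul_le_mul_of_nonneg_left hp hM

lemma convComb_mono {ν : ℕ} {X : Set (Fin ν → ℝ)} (hX : X.Nonempty) {k l : ℕ} (hkl : k ≤ l) :
    convComb X k ⊆ convComb X l := by
  obtain ⟨d, rfl⟩ := Nat.exists_eq_add_of_le hkl
  obtain ⟨x₀, hx₀⟩ := hX
  rintro x ⟨xs, lam, hxs, hlam, hsum, rfl⟩
  refine ⟨Fin.append xs fun _ => x₀, Fin.append lam fun _ => 0, fun i => ?_, fun i => ?_, ?_, ?_⟩
  · refine Fin.addCases (fun i => ?_) (fun i => ?_) i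
    · simpa using hxs i
    · simpa using hx₀
  · refine Fin.addCases (fun i => ?_) (fun i => ?_) i
    · simpa using hlam i
    · simp
  · simpa [Fin.sum_univ_add] using hsum
  · simp [Fin.sum_univ_add]

lemma convComb_nonempty {ν : ℕ} {X : Set (Fin ν → ℝ)} (hX : X.Nonempty) {k : ℕ} (hk : 1 ≤ k) :
    (convComb X k).Nonempty := by
  obtain ⟨x₀, hx₀⟩ := hX
  exact ⟨x₀, convComb_mono ⟨x₀, hx₀⟩ hk
    ⟨fun _ => x₀, fun _ => 1, fun _ => hx₀, fun _ => zero_le_one, by simp, by simp⟩⟩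

lemma bddAbove_image_dot {ν : ℕ} {U : Set (Fin ν → ℝ)} (hU : IsCompact U) (x : Fin ν → ℝ) :
    BddAbove ((fun c => dot c x) '' U) :=
  (hU.image (by unfold dot; fun_prop)).bddAbove

lemma le_dot_of_mem_convComb {ν : ℕ} {X : Set (Fin ν → ℝ)} {c x : Fin ν → ℝ} {k : ℕ} {b : ℝ}
    (hb : ∀ y ∈ X, b ≤ dot c y) (hx : x ∈ convComb X k) : b ≤ dot c x := by
  obtain ⟨xs, lam, hxs, hlam, hsum, rfl⟩ := hx
  rw [dot_sum_smul]
  calc b = ∑ i, lam i * b := by rw [← Finset.sum_mul, hsum, one_mul]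
    _ ≤ _ := Finset.sum_le_sum fun i _ => mul_le_mul_of_nonneg_left (hb _ (hxs i)) (hlam i)

/-- `opt` is antitone in the number of points, provided one scenario in `U` is bounded below
on `X`. -/
lemma optVal_anti {ν : ℕ} {X U : Set (Fin ν → ℝ)} (hX : X.Nonempty) (hU : IsCompact U)
    {c : Fin ν → ℝ} (hcU : c ∈ U) {b : ℝ} (hb : ∀ y ∈ X, b ≤ dot c y)
    {k l : ℕ} (hk : 1 ≤ k) (hkl : k ≤ l) : optVal X U l ≤ optVal X U k := by
  refine csInf_le_csInf ⟨b, ?_⟩ ((convComb_nonempty hX hk).image _)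
    (Set.image_mono (convComb_mono hX hkl))
  rintro _ ⟨x, hx, rfl⟩
  exact (le_dot_of_mem_convComb hb hx).trans
    (le_csSup (bddAbove_image_dot hU x) (Set.mem_image_of_mem _ hcU))

/-- The tail beyond index `k` of a nonincreasing probability vector has mass at most
`(n - k) / (k + 1)`. -/
lemma sum_tail_le {n k : ℕ} (hkn : k ≤ n) {lam : Fin n → ℝ} (h0 : ∀ i, 0 ≤ lam i)
    (hsum : ∑ i, lam i = 1) (hanti : Antitone lam) :
    ∑ i ∈ Finset.univ.filter (fun i : Fin n => ¬ (i : ℕ) < k), lam i ≤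
      ((n : ℝ) - k) / ((k : ℝ) + 1) := by
  have hpt : ∀ i : Fin n, ¬ (i : ℕ) < k → lam i ≤ 1 / ((k : ℝ) + 1) := by
    intro i hi
    rw [not_lt] at hi
    rw [le_div_iff₀ (by positivity)]
    let m : Fin n := ⟨k, hi.trans_lt i.2⟩
    calc lam i * ((k : ℝ) + 1) = (Finset.Iic m).card • lam i := by
          rw [Fin.card_Iic, nsmul_eq_mul, mul_comm]; push_cast; rfl
      _ ≤ ∑ j ∈ Finset.Iic m, lam j := Finset.card_nsmul_le_sum _ _ _ fun j hj =>
          hanti ((Finset.mem_Iic.mp hj).trans hi)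
      _ ≤ ∑ j, lam j :=
          Finset.sum_le_sum_of_subset_of_nonneg (Finset.subset_univ _) fun j _ _ => h0 j
      _ = 1 := hsum
  have hcard : (Finset.univ.filter fun i : Fin n => ¬ (i : ℕ) < k).card = n - k := by
    have h := Finset.card_filter_add_card_filter_not (s := Finset.univ)
      (fun i : Fin n => (i : ℕ) < k)
    rw [Fin.card_filter_val_lt, Finset.card_univ, Fintype.card_fin] at h
    omega
  calc _ ≤ (Finset.univ.filter fun i : Fin n => ¬ (i : ℕ) < k).card • (1 / ((k : ℝ) + 1)) :=
        Finset.sum_le_card_nsmul _ _ _ fun i hi => hpt i (Finset.mem_filter.mp hi).2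
    _ = _ := by rw [hcard, nsmul_eq_mul, Nat.cast_sub hkn, mul_one_div]

/-- For `1 ≤ k ≤ k' ≤ n`, `app(k) ≤ opt(k') + M·(n−k)/(k+1)`
with `M = M_∞·p̄ − m_∞·p`. -/
theorem stmt6 (n : ℕ) (hn : 0 < n)
    (X : Set (Fin n → ℝ)) (hXfin : X.Finite) (hXne : X.Nonempty)
    (hXbin : ∀ x ∈ X, ∀ j, x j = 0 ∨ x j = 1)
    (U : Set (Fin n → ℝ)) (hUne : U.Nonempty) (hUcomp : IsCompact U) (hUconv : Convex ℝ U)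
    (m_inf M_inf : ℝ) (hm : 0 < m_inf) (hmM : m_inf ≤ M_inf)
    (hc : ∀ c ∈ U, ∀ j, m_inf ≤ c j ∧ c j ≤ M_inf)
    (p pbar : ℝ) (hp0 : 0 ≤ p) (hppbar : p ≤ pbar)
    (hpx : ∀ x ∈ X, p ≤ zeroNorm x ∧ zeroNorm x ≤ pbar)
    (xs : Fin n → (Fin n → ℝ)) (lam : Fin n → ℝ)
    (hxs : ∀ i, xs i ∈ X) (hlam0 : ∀ i, 0 ≤ lam i) (hlamsum : (∑ i, lam i) = 1)
    (hlamsort : ∀ i j : Fin n, i ≤ j → lam j ≤ lam i)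
    (hopt : objSup U (∑ i, lam i • xs i) = optVal X U n)
    (k k' : ℕ) (hk : 1 ≤ k) (hkk' : k ≤ k') (hk'n : k' ≤ n) :
    appVal U xs k ≤ optVal X U k' +
      (M_inf * pbar - m_inf * p) * (((n : ℝ) - k) / ((k : ℝ) + 1)) := by
  have hM : 0 ≤ M_inf := hm.le.trans hmM
  have hlow : ∀ c ∈ U, ∀ x ∈ X, m_inf * p ≤ dot c x := fun c hcU x hx =>
    le_dot_of_binary (hXbin x hx) hm.le (fun j => (hc c hcU j).1) (hpx x hx).1
  have hup : ∀ c ∈ U, ∀ x ∈ X, dot c x ≤ M_inf * pbar := fun c hcU x hx =>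
    dot_le_of_binary (hXbin x hx) hM (fun j => (hc c hcU j).2) (hpx x hx).2
  have hgap : 0 ≤ M_inf * pbar - m_inf * p :=
    sub_nonneg.mpr (mul_le_mul hmM hppbar hp0 hM)
  obtain ⟨c₀, hc₀⟩ := hUne
  have hopt' : objSup U (∑ i, lam i • xs i) ≤ optVal X U k' :=
    hopt.le.trans (optVal_anti hXne hUcomp hc₀ (hlow c₀ hc₀) (hk.trans hkk') hk'n)
  have htail := sum_tail_le (hkk'.trans hk'n) hlam0 hlamsum fun i j => hlamsort i j
  refine csSup_le (Set.Nonempty.image _ ⟨c₀, hc₀⟩) ?_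
  rintro _ ⟨c, hcU, rfl⟩
  set μ := ⨅ i : {i : Fin n // (i : ℕ) < k}, dot c (xs i.1)
  have hμle : ∀ i : Fin n, (i : ℕ) < k → μ ≤ dot c (xs i) := fun i hi =>
    ciInf_le (Set.finite_range _).bddBelow (⟨i, hi⟩ : {i : Fin n // (i : ℕ) < k})
  have hμup : μ ≤ M_inf * pbar := (hμle ⟨0, hn⟩ hk).trans (hup c hcU _ (hxs _))
  have hsup : dot c (∑ i, lam i • xs i) ≤ objSup U (∑ i, lam i • xs i) :=
    le_csSup (bddAbove_image_dot hUcomp _) (Set.mem_image_of_mem _ hcU)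
  have hmain : μ - (M_inf * pbar - m_inf * p) *
      ∑ i ∈ Finset.univ.filter (fun i : Fin n => ¬ (i : ℕ) < k), lam i
      ≤ dot c (∑ i, lam i • xs i) := by
    rw [dot_sum_smul, Finset.sum_filter, Finset.mul_sum]
    calc _ = ∑ i : Fin n, (lam i * μ -
          (M_inf * pbar - m_inf * p) * if ¬ (i : ℕ) < k then lam i else 0) := by
          rw [Finset.sum_sub_distrib, ← Finset.sum_mul, hlamsum, one_mul]
      _ ≤ _ := Finset.sum_le_sum fun i _ => by
          by_cases hi : (i : ℕ) < k
          · simpa [hi] using mul_le_mul_of_nonneg_left (hμle i hi) (hlam0 i)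
          · have h := mul_le_mul_of_nonneg_left
              (show μ - (M_inf * pbar - m_inf * p) ≤ dot c (xs i) by
                linarith [hlow c hcU _ (hxs i)]) (hlam0 i)
            simp only [hi, not_false_eq_true, if_true]
            linarith
  change μ ≤ _
  linarith [mul_le_mul_of_nonneg_left htail hgap]
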